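/- arXiv:math/0206131 — 6 statements merged into one kernel-verified Lean document; each statement's English description precedes it below -/
import Mathlib

section
/- Let G be a group acting on a set X, let n ≥ 2, let f_1, …, f_n be elements of G, and let ‖·‖ : X → ℝ_{≥0} be a function. Suppose there exist n non-empty, pairwise disjoint subsets X_1, …, X_n of X such that for every index i, every nonzero integer k, and every x ∈ X \ X_i, one has f_i^k · x ∈ X_i and ‖f_i^k · x‖ > ‖x‖. Then the group homomorphism from the free group on n generators to G sending the i-th generator to f_i is injective; in particular the subgroup ⟨f_1, …, f_n⟩ of G is free of rank n. -/
/-- Tower ping-pong lemma (Lemma 2.4), freeness conclusion: if in addition to the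
ping-pong conditions every nonzero power of `f i` strictly increases the norm of every
point outside `Xs i`, then the induced map from the free group on `n` generators is
injective. -/
theorem towerPingPong_free {G X : Type*} [Group G] [MulAction G X] {n : ℕ} (hn : 2 ≤ n)
    (f : Fin n → G) (norm : X → NNReal) (Xs : Fin n → Set X)
    (hne : ∀ i, (Xs i).Nonempty)
    (hdisj : Pairwise (Function.onFun Disjoint Xs))
    (hmap : ∀ i : Fin n, ∀ k : ℤ, k ≠ 0 → ∀ x : X, x ∉ Xs i →
      (f i ^ k) • x ∈ Xs i ∧ norm x < norm ((f i ^ k) • x)) :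
    Function.Injective (FreeGroup.lift f : FreeGroup (Fin n) →* G) := by
  have : NeZero n := ⟨by omega⟩
  have : Nontrivial (Fin n) := Fin.nontrivial_iff_two_le.mpr hn
  let φ : ∀ i : Fin n, FreeGroup Unit →* G := fun i => FreeGroup.lift fun _ => f i
  have hlift : FreeGroup.lift f =
      (Monoid.CoprodI.lift φ).comp (freeGroupEquivCoprodI (ι := Fin n)).toMonoidHom := by
    ext i
    simp [φ]
  rw [hlift, MonoidHom.coe_comp]
  refine Function.Injective.comp ?_ (MulEquiv.injective freeGroupEquivCoprodI)
  refine Monoid.CoprodI.lift_injective_of_ping_pong φ (Or.inr ⟨0, ?_⟩) Xs hne hdisj ?_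
  · rw [FreeGroup.freeGroupUnitEquivInt.cardinal_eq, Cardinal.mk_denumerable]
    exact Cardinal.natCast_le_aleph0
  · intro i j hij
    refine FreeGroup.freeGroupUnitEquivInt.forall_congr_left.mpr fun k hk => ?_
    rintro _ ⟨x, hx, rfl⟩
    change φ i (FreeGroup.of () ^ k) • x ∈ Xs i
    have hk0 : k ≠ 0 := by
      rintro rfl
      exact hk (by simp [FreeGroup.freeGroupUnitEquivInt])
    simpa [φ] using (hmap i k hk0 x (Set.disjoint_right.mp (hdisj hij) hx)).1
end

section
/- Let G be a group acting on a set X, let n ≥ 2, let f_1, …, f_n be elements of G, and let ‖·‖ : X → ℝ_{≥0} be a function. Suppose there exist n non-empty, pairwise disjoint subsets X_1, …, X_n of X such that for every index i, every nonzero integer k, and every x ∈ X \ X_i, one has f_i^k · x ∈ X_i and ‖f_i^k · x‖ > ‖x‖. Let Γ be the subgroup of G generated by f_1, …, f_n, and let g ∈ Γ be an element which is not of the form h f_i^m h⁻¹ for any h ∈ Γ, any index i, and any integer m. Then the action of g on X has no periodic points: for every x ∈ X and every integer k ≥ 1, g^k · x ≠ x. -/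
/-- `g` maps the complement of `B` into `A` and strictly increases `norm` there. -/
def Attracts {G X : Type*} [Group G] [MulAction G X] (norm : X → NNReal) (g : G)
    (A B : Set X) : Prop :=
  ∀ x ∉ B, g • x ∈ A ∧ norm x < norm (g • x)

namespace Attracts

variable {G X : Type*} [Group G] [MulAction G X] {norm : X → NNReal}

theorem mul {g h : G} {A B C D : Set X} (hg : Attracts norm g A B) (hh : Attracts norm h C D)
    (hd : Disjoint B C) : Attracts norm (g * h) A D := by
  intro x hx
  obtain ⟨h₁, h₂⟩ := hh x hx
  obtain ⟨h₃, h₄⟩ := hg (h • x) (Set.disjoint_right.mp hd h₁)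
  rw [mul_smul]
  exact ⟨h₃, h₂.trans h₄⟩

theorem pow {g : G} {A B : Set X} (hg : Attracts norm g A B) (hd : Disjoint A B) {k : ℕ}
    (hk : 1 ≤ k) : Attracts norm (g ^ k) A B := by
  induction k, hk using Nat.le_induction with
  | base => simpa using hg
  | succ k _ ih =>
    rw [pow_succ]
    exact ih.mul hg hd.symm

theorem pow_smul_ne {g : G} {A B : Set X} (hg : Attracts norm g A B)
    (hg' : Attracts norm g⁻¹ B A) (hd : Disjoint A B) {k : ℕ} (hk : 1 ≤ k) (x : X) :
    g ^ k • x ≠ x := by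
  intro hx
  by_cases hB : x ∈ B
  · have h := (hg'.pow hd.symm hk x (Set.disjoint_right.mp hd hB)).2
    rw [inv_pow, inv_smul_eq_iff.mpr hx.symm] at h
    exact h.false
  · have h := (hg.pow hd hk x hB).2
    rw [hx] at h
    exact h.false

end Attracts

/-- The product of the powers `f i ^ m` over a list of pairs `(i, m)`. -/
def syllableProd {G ι : Type*} [Group G] (f : ι → G) (L : List (ι × ℤ)) : G :=
  (L.map fun p => f p.1 ^ p.2).prod

section syllableProd

variable {G ι : Type*} [Group G] (f : ι → G)

@[simp]
theorem syllableProd_nil : syllableProd f [] = 1 := rfl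

@[simp]
theorem syllableProd_cons (p : ι × ℤ) (L : List (ι × ℤ)) :
    syllableProd f (p :: L) = f p.1 ^ p.2 * syllableProd f L := by
  simp [syllableProd]

@[simp]
theorem syllableProd_append (L M : List (ι × ℤ)) :
    syllableProd f (L ++ M) = syllableProd f L * syllableProd f M := by
  simp [syllableProd]

theorem exists_syllableProd_eq {g : G} (hg : g ∈ Subgroup.closure (Set.range f)) :
    ∃ L, syllableProd f L = g := by
  induction hg using Subgroup.closure_induction_left with
  | one => exact ⟨[], rfl⟩
  | mul_left x hx y _ ih =>
    obtain ⟨i, rfl⟩ := hx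
    obtain ⟨L, rfl⟩ := ih
    exact ⟨(i, 1) :: L, by simp⟩
  | inv_mul_cancel x hx y _ ih =>
    obtain ⟨i, rfl⟩ := hx
    obtain ⟨L, rfl⟩ := ih
    exact ⟨(i, -1) :: L, by simp⟩

/-- Every element of the subgroup generated by `f` is conjugate to a power of some `f i`, or to
a cyclically reduced product of such powers with at least two factors. -/
theorem exists_conj_syllableProd [Nonempty ι] {g : G}
    (hg : g ∈ Subgroup.closure (Set.range f)) :
    (∃ h ∈ Subgroup.closure (Set.range f), ∃ i, ∃ m : ℤ, g = h * f i ^ m * h⁻¹) ∨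
    ∃ h, ∃ L, ∃ hL : L ≠ [], g = h * syllableProd f L * h⁻¹ ∧
      L.IsChain (fun p q => p.1 ≠ q.1) ∧ (∀ p ∈ L, p.2 ≠ 0) ∧
      (L.head hL).1 ≠ (L.getLast hL).1 := by
  classical
  have hex : ∃ N, ∃ h ∈ Subgroup.closure (Set.range f), ∃ L : List (ι × ℤ),
      L.length = N ∧ g = h * syllableProd f L * h⁻¹ := by
    obtain ⟨L, rfl⟩ := exists_syllableProd_eq f hg
    exact ⟨_, 1, one_mem _, L, rfl, by simp⟩
  obtain ⟨h, hh, L, hlen, hgL⟩ := Nat.find_spec hex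
  have hmin : ∀ h' ∈ Subgroup.closure (Set.range f), ∀ L' : List (ι × ℤ),
      g = h' * syllableProd f L' * h'⁻¹ → L.length ≤ L'.length := fun h' hh' L' hL' =>
    hlen ▸ Nat.find_min' hex ⟨h', hh', L', rfl, hL'⟩
  rcases L.eq_nil_or_concat' with rfl | ⟨M, ⟨j, b⟩, rfl⟩
  · exact .inl ⟨h, hh, Classical.arbitrary ι, 0, by simpa using hgL⟩
  rcases M with _ | ⟨⟨i, a⟩, M⟩
  · exact .inl ⟨h, hh, j, b, by simpa using hgL⟩
  refine .inr ⟨h, _, by simp, hgL, ?_, ?_, ?_⟩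
  · rw [List.isChain_iff_forall_rel_of_append_cons_cons]
    rintro ⟨k, c⟩ ⟨l, d⟩ A B hAB (rfl : k = l)
    have := hmin h hh (A ++ (k, c + d) :: B) (by rw [hgL, hAB]; simp [zpow_add, mul_assoc])
    rw [hAB] at this
    simp at this
  · rintro ⟨k, c⟩ hp (rfl : c = 0)
    obtain ⟨A, B, hAB⟩ := List.append_of_mem hp
    have := hmin h hh (A ++ B) (by rw [hgL, hAB]; simp)
    rw [hAB] at this
    simp at this
  · intro hij
    obtain rfl : i = j := by simpa using hij
    have := hmin (h * (f i ^ b)⁻¹)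
      (mul_mem hh (inv_mem (zpow_mem (Subgroup.subset_closure (Set.mem_range_self i)) b)))
      ((i, b + a) :: M) (by rw [hgL]; simp [zpow_add, mul_assoc])
    simp at this

end syllableProd

theorem attracts_syllableProd {G X ι : Type*} [Group G] [MulAction G X] {f : ι → G}
    {norm : X → NNReal} {Xs : ι → Set X} (hdisj : Pairwise (Function.onFun Disjoint Xs))
    (hmap : ∀ i, ∀ k : ℤ, k ≠ 0 → Attracts norm (f i ^ k) (Xs i) (Xs i))
    {L : List (ι × ℤ)} (hL : L ≠ []) (hchain : L.IsChain (fun p q => p.1 ≠ q.1))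
    (hne : ∀ p ∈ L, p.2 ≠ 0) :
    Attracts norm (syllableProd f L) (Xs (L.head hL).1) (Xs (L.getLast hL).1) ∧
    Attracts norm (syllableProd f L)⁻¹ (Xs (L.getLast hL).1) (Xs (L.head hL).1) := by
  induction L with
  | nil => exact absurd rfl hL
  | cons p L ih =>
    have hp := hne p (by simp)
    have h₁ := hmap p.1 p.2 hp
    have h₂ : Attracts norm (f p.1 ^ p.2)⁻¹ (Xs p.1) (Xs p.1) := by
      simpa using hmap p.1 (-p.2) (neg_ne_zero.mpr hp)
    rcases L with _ | ⟨q, L⟩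
    · simpa using And.intro h₁ h₂
    · rw [List.isChain_cons_cons] at hchain
      obtain ⟨h₃, h₄⟩ := ih (by simp) hchain.2 fun r hr => hne r (List.mem_cons_of_mem _ hr)
      rw [syllableProd_cons, mul_inv_rev, List.getLast_cons (List.cons_ne_nil q L)]
      exact ⟨h₁.mul h₃ (hdisj hchain.1), h₄.mul h₂ (hdisj hchain.1.symm)⟩


/-- Tower ping-pong lemma (Lemma 2.4), no-periodic-points conclusion: under the tower
ping-pong conditions, every element of `Γ = ⟨f 1, …, f n⟩` which is not conjugate (in `Γ`)
to a power of some `f i` acts on `X` without periodic points. -/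
theorem towerPingPong_noPeriodicPoints {G X : Type*} [Group G] [MulAction G X] {n : ℕ}
    (hn : 2 ≤ n) (f : Fin n → G) (norm : X → NNReal) (Xs : Fin n → Set X)
    (hne : ∀ i, (Xs i).Nonempty)
    (hdisj : Pairwise (Function.onFun Disjoint Xs))
    (hmap : ∀ i : Fin n, ∀ k : ℤ, k ≠ 0 → ∀ x : X, x ∉ Xs i →
      (f i ^ k) • x ∈ Xs i ∧ norm x < norm ((f i ^ k) • x))
    (g : G) (hg : g ∈ Subgroup.closure (Set.range f))
    (hnc : ¬ ∃ h ∈ Subgroup.closure (Set.range f), ∃ i : Fin n, ∃ m : ℤ,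
      g = h * f i ^ m * h⁻¹) :
    ∀ x : X, ∀ k : ℕ, 1 ≤ k → g ^ k • x ≠ x := by
  intro x k hk hx
  have : Nonempty (Fin n) := ⟨⟨0, by omega⟩⟩
  obtain h | ⟨h, L, hL, rfl, hchain, hL0, hends⟩ := exists_conj_syllableProd f hg
  · exact hnc h
  · obtain ⟨h₁, h₂⟩ := attracts_syllableProd hdisj hmap hL hchain hL0
    refine h₁.pow_smul_ne h₂ (hdisj hends) hk (h⁻¹ • x) ?_
    rw [conj_pow, mul_smul, mul_smul] at hx
    exact eq_inv_smul_iff.mpr hx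
end

section
/- Let G be a group and let a, b ∈ G satisfy the braid relation a b a = b a b. Then (a b³)³ = (a b)⁶. -/
/-- From the braid relation `a b a = b a b` one has `(a b³)³ = (a b)⁶`
(proof of Theorem 2.7). -/
theorem braid_ab_cube_cube {G : Type*} [Group G] (a b : G) (hbraid : a * b * a = b * a * b) :
    (a * b ^ 3) ^ 3 = (a * b) ^ 6 := by
  have hab : (a * b * a) * b = a * (a * b * a) := by
    rw [hbraid]; simp only [← mul_assoc, hbraid]
  have hba : (a * b * a) * a = b * (a * b * a) := by
    nth_rewrite 1 [hbraid]; simp only [mul_assoc]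
  have hcube : (a * b) ^ 3 = (a * b * a) * (b * a * b) := by
    simp only [pow_succ, pow_zero, one_mul, mul_assoc]
  have hcomm : Commute ((a * b) ^ 3) b := by
    rw [hcube, ← hbraid]
    exact (mul_assoc _ _ _).trans <| by rw [hab, ← mul_assoc, hba, mul_assoc]
  have hword : a * b ^ 2 * a * b ^ 2 = (a * b) ^ 3 := by
    calc a * b ^ 2 * a * b ^ 2 = a * b * (b * a * b) * b := by
          simp only [pow_succ, pow_zero, one_mul, mul_assoc]
      _ = (a * b) ^ 3 := by
          rw [← hbraid]; simp only [pow_succ, pow_zero, one_mul, mul_assoc]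
  calc (a * b ^ 3) ^ 3 = a * b ^ 2 * ((b * a * b) * b) * (b * a * b) * b ^ 2 := by
        simp only [pow_succ, pow_zero, one_mul, mul_assoc]
    _ = a * b ^ 2 * a * ((a * b) ^ 3 * b ^ 2) := by
        rw [hcube, ← hbraid, hab]; simp only [mul_assoc]
    _ = a * b ^ 2 * a * b ^ 2 * (a * b) ^ 3 := by
        rw [(hcomm.pow_right 2).eq, ← mul_assoc]
    _ = (a * b) ^ 6 := by rw [hword, ← pow_add]
end

section
/- Let G be a group and let a, b ∈ G satisfy the braid relation a b a = b a b, and suppose that (a b)⁶ commutes with a and with b. Then (a b²)⁴ commutes with every element of the subgroup of G generated by a and b²; that is, (a b²)⁴ lies in the centralizer of Subgroup.closure {a, b²}. -/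
/-- If `a` and `b` satisfy the braid relation, then `(a b²)² = (a b)³`. -/
theorem mul_sq_sq_eq_mul_pow_three {M : Type*} [Monoid M] {a b : M}
    (hbraid : a * b * a = b * a * b) : (a * b ^ 2) ^ 2 = (a * b) ^ 3 := by
  calc (a * b ^ 2) ^ 2 = a * b * (b * a * b) * b := by
        simp only [pow_succ, pow_zero, one_mul, mul_assoc]
    _ = a * b * (a * b * a) * b := by rw [hbraid]
    _ = (a * b) ^ 3 := by simp only [pow_succ, pow_zero, one_mul, mul_assoc]


/-- If `a, b` satisfy the braid relation and `(a b)⁶` commutes with `a` and `b`, then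
`(a b²)⁴` is central in `⟨a, b²⟩` (proof of Theorem 2.7). -/
theorem ab_sq_pow_four_central {G : Type*} [Group G] (a b : G)
    (hbraid : a * b * a = b * a * b)
    (hca : Commute ((a * b) ^ 6) a) (hcb : Commute ((a * b) ^ 6) b) :
    (a * b ^ 2) ^ 4 ∈ Subgroup.centralizer ((Subgroup.closure {a, b ^ 2} : Subgroup G) : Set G) := by
  rw [show (a * b ^ 2) ^ 4 = (a * b) ^ 6 by
      rw [pow_mul _ 2 2, mul_sq_sq_eq_mul_pow_three hbraid, ← pow_mul],
    Subgroup.centralizer_closure, Subgroup.mem_centralizer_iff]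
  rintro x (rfl | rfl)
  · exact hca.eq.symm
  · exact (hcb.pow_right 2).eq.symm
end

section
/- Let G be a group and let a, b ∈ G satisfy the braid relation a b a = b a b, and suppose that (a b)⁶ commutes with a and with b. Then (a b³)³ commutes with every element of the subgroup of G generated by a and b³; that is, (a b³)³ lies in the centralizer of Subgroup.closure {a, b³}. -/
theorem braid_mul_cube_pow_three {M : Type*} [Monoid M] {a b : M}
    (hbraid : a * b * a = b * a * b) : (a * b ^ 3) ^ 3 = (a * b) ^ 6 := by
  obtain ⟨d, hd⟩ : ∃ d, d = a * b * a := ⟨_, rfl⟩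
  have hd' : d = b * a * b := hd.trans hbraid
  have hda : d * a = b * d := by
    rw [hd]; nth_rw 1 [hbraid]; simp only [mul_assoc]
  have hdb : d * b = a * d := by
    nth_rw 2 [hd']; rw [hd]; simp only [mul_assoc]
  have hda' (x : M) : d * (a * x) = b * (d * x) := by rw [← mul_assoc, hda, mul_assoc]
  have hdb' (x : M) : d * (b * x) = a * (d * x) := by rw [← mul_assoc, hdb, mul_assoc]
  calc (a * b ^ 3) ^ 3 = a * b * b * (b * a * b) * b * (b * a * b) * b * b := by
        simp only [pow_succ, pow_zero, one_mul, mul_assoc]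
    _ = a * b * b * a * b * b * d * d := by
        rw [← hd']; simp only [mul_assoc, hdb, hda']
    _ = a * b * (b * a * b) * b * d * d := by simp only [mul_assoc]
    _ = (a * b * a) * (b * a * b) * d * d := by
        rw [← hd', ← hd]; simp only [mul_assoc, hdb']
        simp only [← mul_assoc, ← hd]
    _ = (a * b * a) * (b * a * b) * (a * b * a) * (b * a * b) := by rw [← hd, ← hd']
    _ = (a * b) ^ 6 := by simp only [pow_succ, pow_zero, one_mul, mul_assoc]

/-- If `a, b` satisfy the braid relation and `(a b)⁶` commutes with `a` and `b`, then
`(a b³)³` is central in `⟨a, b³⟩` (proof of Theorem 2.7). -/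
theorem ab_cube_pow_three_central {G : Type*} [Group G] (a b : G)
    (hbraid : a * b * a = b * a * b)
    (hca : Commute ((a * b) ^ 6) a) (hcb : Commute ((a * b) ^ 6) b) :
    (a * b ^ 3) ^ 3 ∈ Subgroup.centralizer ((Subgroup.closure {a, b ^ 3} : Subgroup G) : Set G) := by
  rw [Subgroup.centralizer_closure, braid_mul_cube_pow_three hbraid, Subgroup.mem_centralizer_iff]
  rintro g (rfl | rfl)
  · exact hca.eq.symm
  · exact (hcb.pow_right 3).eq.symm
end

section
/- Let G be a group and let a, b ∈ G satisfy the braid relation a b a = b a b, and suppose that (a b)⁶ commutes with a and with b. Then for each n ∈ {1, 2, 3}, the group homomorphism from the free group on two generators to G sending the first generator to a and the second generator to bⁿ is not injective (so the subgroup ⟨a, bⁿ⟩ is not free on the generators a and bⁿ). -/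
/-- In the presence of the braid relation, `a b³` is conjugate to `(a b)²`. -/
lemma mul_pow_three_conj_of_braid {M : Type*} [Monoid M] {a b : M}
    (h : a * b * a = b * a * b) :
    a * b ^ 3 * (a * b * (a * b * a)) = a * b * (a * b * a) * (a * b) ^ 2 := by
  have hb : a * b * a * a = b * (a * b * a) := by
    nth_rw 1 [h]; simp only [mul_assoc]
  calc a * b ^ 3 * (a * b * (a * b * a))
      = a * b * b * (b * a * b) * (a * b * a) := by
        simp only [pow_succ, pow_zero, one_mul, mul_assoc]
    _ = a * b * (b * (a * b * a)) * (a * b * a) := by rw [← h]; simp only [mul_assoc]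
    _ = a * b * (a * b * a * a) * (b * a * b) := by rw [← hb, ← h]
    _ = a * b * (a * b * a) * (a * b) ^ 2 := by simp only [pow_succ, pow_zero, one_mul, mul_assoc]

/-- The braid relation implies the length-four relation between `a` and `b²`. -/
lemma mul_sq_sq_comm_of_braid {M : Type*} [Monoid M] {a b : M}
    (h : a * b * a = b * a * b) : (a * b ^ 2) ^ 2 = (b ^ 2 * a) ^ 2 := by
  calc (a * b ^ 2) ^ 2 = a * b * (b * a * b) * b := by simp only [sq, mul_assoc]
    _ = a * b * (a * b * a) * b := by rw [h]
    _ = (a * b * a) * (b * a * b) := by simp only [mul_assoc]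
    _ = (b * a * b) * (a * b * a) := by rw [h]
    _ = b * (a * b * a) * b * a := by simp only [mul_assoc]
    _ = (b ^ 2 * a) ^ 2 := by rw [h]; simp only [sq, mul_assoc]

/-- If `(a b)⁶` commutes with `a` and `b`, the braid relation gives `(a b³)³ = (a b)⁶`. -/
lemma mul_pow_three_pow_three_of_braid {G : Type*} [Group G] {a b : G}
    (h : a * b * a = b * a * b)
    (hca : Commute ((a * b) ^ 6) a) (hcb : Commute ((a * b) ^ 6) b) :
    (a * b ^ 3) ^ 3 = (a * b) ^ 6 := by
  have hconj : SemiconjBy (a * b * (a * b * a)) ((a * b) ^ 2) (a * b ^ 3) :=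
    (mul_pow_three_conj_of_braid h).symm
  have hpow := hconj.pow_right 3
  rw [← pow_mul] at hpow
  have hcomm : Commute ((a * b) ^ 6) (a * b * (a * b * a)) :=
    (hca.mul_right hcb).mul_right ((hca.mul_right hcb).mul_right hca)
  exact mul_right_cancel (hpow.eq.symm.trans hcomm.eq.symm)

/-- If `a, b` satisfy the braid relation and `(a b)⁶` commutes with `a` and `b`, then for
`n = 1, 2, 3` the subgroup `⟨a, bⁿ⟩` is not free on the generators `a, bⁿ`
(non-free direction of Theorem 2.7). -/
theorem not_free_on_a_bn {G : Type*} [Group G] (a b : G)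
    (hbraid : a * b * a = b * a * b)
    (hca : Commute ((a * b) ^ 6) a) (hcb : Commute ((a * b) ^ 6) b) :
    ∀ n ∈ ({1, 2, 3} : Set ℕ),
      ¬ Function.Injective (FreeGroup.lift ![a, b ^ n] : FreeGroup (Fin 2) →* G) := by
  let x : FreeGroup (Fin 2) := FreeGroup.of 0
  let y : FreeGroup (Fin 2) := FreeGroup.of 1
  rintro n (rfl | rfl | rfl) hinj
  · have hne : x * y * x ≠ y * x * y := by decide
    exact hne (hinj (by simpa [x, y] using hbraid))
  · have hne : (x * y) ^ 2 ≠ (y * x) ^ 2 := by decide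
    exact hne (hinj (by simpa [x, y] using mul_sq_sq_comm_of_braid hbraid))
  · have hne : (x * y) ^ 3 * x ≠ x * (x * y) ^ 3 := by decide
    refine hne (hinj ?_)
    simpa [x, y, mul_pow_three_pow_three_of_braid hbraid hca hcb] using hca.eq
end
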